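/- For every n ≥ 1 and every decreasing tuple μ¹ ∈ ℤ^n there exists a constant C' (depending only on n and μ¹) with the following property: for every integer N > C', all Newton data ν, ν' ∈ ℚ^n, and all b, b' ∈ GL_n(K) such that b is σ-conjugate to b_{min,ν}, b' is σ-conjugate to b_{min,ν'}, μ(b) = μ(b') = μ¹, and μ((bσ)^i) = μ((b'σ)^i) for all i = 1,…,N, one has ν = ν'. (In other words, for N > C' every refined Hodge stratum H_{μ̄,N}(GL_n) whose first entry is μ¹ is contained in a single Newton stratum.) -/

import Mathlib

/-!
Statement 11.  For every `n ≥ 1` and decreasing tuple `μ¹ ∈ ℤ^n` there is a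
constant `C'` (depending only on `n` and `μ¹`) such that for every `N > C'`,
any two elements `b, b' ∈ GL_n(K)` with `μ(b) = μ(b') = μ¹` and
`μ((bσ)^i) = μ((b'σ)^i)` for `i = 1,…,N`, whose Newton points (via the
Dieudonné–Manin classification, `b` σ-conjugate to `b_{min,ν}`, `b'` to
`b_{min,ν'}`) are `ν, ν'`, satisfy `ν = ν'`.
-/

open Matrix

noncomputable section

variable (p : ℕ) [Fact p.Prime] (κ : Type) [Field κ] [IsAlgClosed κ] [CharP κ p]

local notation "𝕎" => WittVector p κ
local notation "K" => FractionRing (WittVector p κ)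

/-- `c ∈ GL_n(W(κ)) ⊆ GL_n(K)`. -/
def IsIntegralUnit {n : ℕ} (c : Matrix (Fin n) (Fin n) K) : Prop :=
  ∃ d : Matrix (Fin n) (Fin n) 𝕎, IsUnit d.det ∧ c = d.map (algebraMap 𝕎 K)

/-- `μ` is the Hodge point of `b`. -/
def IsHodgePoint {n : ℕ} (b : Matrix (Fin n) (Fin n) K) (μ : Fin n → ℤ) : Prop :=
  Antitone μ ∧ ∃ c₁ c₂ : Matrix (Fin n) (Fin n) K, IsIntegralUnit p κ c₁ ∧ IsIntegralUnit p κ c₂ ∧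
    b = c₁ * Matrix.diagonal (fun i => (p : K) ^ (μ i)) * c₂

/-- `twistedPow σ b i = (bσ)^i = b·σ(b)·σ²(b)···σ^{i−1}(b)`. -/
def twistedPow {n : ℕ} (σ : K ≃+* K) (b : Matrix (Fin n) (Fin n) K) :
    ℕ → Matrix (Fin n) (Fin n) K
  | 0 => 1
  | (i + 1) => b * (twistedPow σ b i).map ⇑σ

/-- The matrix `B_{m,h}`. -/
def Bmat (m : ℕ) (h : ℤ) : Matrix (Fin m) (Fin m) K :=
  fun r j => if (r : ℤ) % m = ((j : ℤ) + h) % m then (p : K) ^ (((j : ℤ) + h) / m) else 0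

/-- A Newton datum for `GL_n`, encoded by its superbasic blocks `(mᵢ, hᵢ)`
(coprime, slopes `hᵢ/mᵢ` weakly decreasing), block `i` occupying the `i`-th
consecutive segment of `Fin n`. -/
structure BlockData (n : ℕ) where
  /-- number of blocks -/
  len : ℕ
  /-- sizes of the blocks -/
  m : Fin len → ℕ
  /-- numerators of the blocks -/
  h : Fin len → ℤ
  m_pos : ∀ i, 0 < m i
  coprime : ∀ i, Int.gcd (m i) (h i) = 1
  slopes_antitone : Antitone fun i => (h i : ℚ) / (m i)
  /-- the identification of the blocks with consecutive segments of `Fin n`, in order -/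
  equiv : (Σ i : Fin len, Fin (m i)) ≃ Fin n
  equiv_val : ∀ x : (Σ i : Fin len, Fin (m i)),
    ((equiv x : ℕ)) = (∑ j : Fin len, if j < x.1 then m j else 0) + (x.2 : ℕ)

/-- The Newton point `ν` determined by the block data: `m i` slopes `h i / m i`. -/
def nuOf {n : ℕ} (D : BlockData n) : Fin n → ℚ :=
  fun j => (D.h (D.equiv.symm j).1 : ℚ) / (D.m (D.equiv.symm j).1)

/-- The minimal element `b_{min,ν}`: block diagonal with blocks `B_{mᵢ,hᵢ}`. -/
def minMatrix {n : ℕ} (D : BlockData n) : Matrix (Fin n) (Fin n) K :=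
  (Matrix.blockDiagonal' fun i => Bmat p κ (D.m i) (D.h i)).submatrix
    ⇑D.equiv.symm ⇑D.equiv.symm

/-- The distance `|x, x'| = Σ_{i : xᵢ > x'ᵢ} (xᵢ − x'ᵢ)` between two tuples. -/
def tdist {n : ℕ} (x x' : Fin n → ℚ) : ℚ := ∑ i, max (x i - x' i) 0


theorem core_span {R : Type*} [CommRing R] [IsDomain R] [IsPrincipalIdealRing R] [IsLocalRing R]
    (n : ℕ) (τ : R →+* R)
    (hτ : ∀ r ∈ IsLocalRing.maximalIdeal R, τ r ∈ IsLocalRing.maximalIdeal R)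
    (Ψ : (Fin n → R) → (Fin n → R)) (hadd : ∀ u v, Ψ (u + v) = Ψ u + Ψ v)
    (hsmul : ∀ (r : R) v, Ψ (r • v) = τ r • Ψ v) (v : Fin n → R) (i : ℕ) :
    Ψ^[i] v ∈ Submodule.span R (Set.range fun j : Fin n => Ψ^[j] v) := by
  classical
  let Ψl : (Fin n → R) →ₛₗ[τ] (Fin n → R) :=
    { toFun := Ψ, map_add' := hadd, map_smul' := hsmul }
  set Lv : Submodule R (Fin n → R) := Submodule.span R (Set.range fun j : ℕ => Ψ^[j] v) with hLv
  have memL : ∀ j, Ψ^[j] v ∈ Lv := fun j => Submodule.subset_span ⟨j, rfl⟩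
  obtain ⟨d, ⟨B⟩⟩ := Submodule.nonempty_basis_of_pid (Pi.basisFun R (Fin n)) Lv
  have hd : d ≤ n := by
    have h1 := Submodule.finrank_le Lv
    rw [Module.finrank_eq_card_basis B] at h1
    simpa using h1
  let k := IsLocalRing.ResidueField R
  let z : Fin (n+1) → (Fin d → k) := fun j l => IsLocalRing.residue R (B.repr ⟨_, memL j⟩ l)
  have hz : ¬ LinearIndependent k z := by
    intro h
    have := h.fintype_card_le_finrank
    simp at this
    omega
  rw [Fintype.not_linearIndependent_iff] at hz
  obtain ⟨gk, hg, i0, hi0⟩ := hz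
  choose gr hgr using fun j => IsLocalRing.residue_surjective (gk j)
  let S : Finset (Fin (n+1)) := Finset.univ.filter fun j => gk j ≠ 0
  have hS : S.Nonempty := ⟨i0, by simp [S, hi0]⟩
  set J := S.max' hS with hJ
  have hJ0 : gk J ≠ 0 := by
    have := S.max'_mem hS
    simpa [S] using this
  have hJmax : ∀ j, J < j → gk j = 0 := by
    intro j hj
    by_contra h
    have := S.le_max' j (by simp [S, h])
    exact absurd hj (not_lt.mpr this)
  set I := IsLocalRing.maximalIdeal R with hI
  set P : Submodule R (Fin n → R) := Submodule.span R (Set.range fun j : Fin J => Ψ^[j] v) with hP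
  -- the relation
  have hrel : ∑ j, gr j • Ψ^[(j : ℕ)] v ∈ I • Lv := by
    have h1 : ∀ l, B.repr (∑ j, gr j • (⟨_, memL j⟩ : Lv)) l ∈ I := by
      intro l
      rw [← IsLocalRing.residue_eq_zero_iff]
      have := congrFun hg l
      simp only [Finset.sum_apply, Pi.smul_apply, z, smul_eq_mul, Pi.zero_apply] at this
      simp only [map_sum, map_smul, Finsupp.coe_finsetSum, Finset.sum_apply, Finsupp.smul_apply,
        smul_eq_mul, map_mul, hgr]
      exact this
    have h2 := B.sum_repr (∑ j, gr j • (⟨_, memL j⟩ : Lv))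
    have h3 := congrArg Lv.subtype h2
    simp only [map_sum, map_smul, Submodule.subtype_apply] at h3
    rw [← h3]
    refine Submodule.sum_mem _ fun l _ => Submodule.smul_mem_smul ?_ (B l).2
    have := h1 l
    simpa only [map_sum, map_smul] using this
  have hsmulmem : ∀ j : Fin (n+1), gk j = 0 → gr j • Ψ^[(j:ℕ)] v ∈ I • Lv := by
    intro j hj
    refine Submodule.smul_mem_smul ?_ (memL j)
    rw [← IsLocalRing.residue_eq_zero_iff, hgr, hj]
  have hJmem : Ψ^[(J : ℕ)] v ∈ P ⊔ I • Lv := by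
    have hu : IsUnit (gr J) := by
      rw [← IsLocalRing.residue_ne_zero_iff_isUnit, hgr]; exact hJ0
    have h1 : gr J • Ψ^[(J : ℕ)] v ∈ P ⊔ I • Lv := by
      have h2 : gr J • Ψ^[(J : ℕ)] v = ∑ j, gr j • Ψ^[(j : ℕ)] v
          - ∑ j ∈ Finset.univ.erase J, gr j • Ψ^[(j : ℕ)] v := by
        rw [← Finset.add_sum_erase _ _ (Finset.mem_univ J)]; simp
      rw [h2]
      refine Submodule.sub_mem _ (Submodule.mem_sup_right hrel) (Submodule.sum_mem _ fun j hj => ?_)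
      rcases lt_or_gt_of_ne (Finset.ne_of_mem_erase hj) with h | h
      · exact Submodule.mem_sup_left (Submodule.smul_mem _ _ (Submodule.subset_span ⟨⟨j, h⟩, rfl⟩))
      · exact Submodule.mem_sup_right (hsmulmem j (hJmax j h))
    obtain ⟨u, hu⟩ := hu
    rw [← hu] at h1
    have := Submodule.smul_mem _ (↑u⁻¹ : R) h1
    simpa [smul_smul] using this
  have hstab : ∀ y ∈ P ⊔ I • Lv, Ψ y ∈ P ⊔ I • Lv := by
    have : P ⊔ I • Lv ≤ (P ⊔ I • Lv).comap Ψl := by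
      refine sup_le ?_ ?_
      · rw [hP, Submodule.span_le]
        rintro _ ⟨j, rfl⟩
        change Ψ (Ψ^[j] v) ∈ P ⊔ I • Lv
        rw [← Function.iterate_succ_apply' Ψ]
        rcases Nat.lt_or_ge (j+1) J with h | h
        · exact Submodule.mem_sup_left (Submodule.subset_span ⟨⟨j+1, h⟩, rfl⟩)
        · have : (j : ℕ) + 1 = J := le_antisymm j.2 h
          rw [Nat.succ_eq_add_one, this]; exact hJmem
      · rw [Submodule.smul_le]
        intro r hr y hy
        change Ψ (r • y) ∈ P ⊔ I • Lv
        rw [hsmul]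
        refine Submodule.mem_sup_right (Submodule.smul_mem_smul (hτ r hr) ?_)
        have : Lv ≤ Lv.comap Ψl := by
          conv_lhs => rw [hLv]
          rw [Submodule.span_le]
          rintro _ ⟨j, rfl⟩
          change Ψ (Ψ^[j] v) ∈ Lv
          rw [← Function.iterate_succ_apply' Ψ]
          exact memL _
        exact this hy
    exact this
  have hall : ∀ i, Ψ^[i] v ∈ P ⊔ I • Lv := by
    intro i
    induction i with
    | zero =>
      rcases Nat.eq_zero_or_pos J with h | h
      · have := hJmem
        rwa [h] at this
      · exact Submodule.mem_sup_left (Submodule.subset_span ⟨⟨0, h⟩, rfl⟩)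
    | succ i ih =>
      rw [Function.iterate_succ_apply']
      exact hstab _ ih
  have hle : Lv ≤ P := by
    refine Submodule.le_of_le_smul_of_le_jacobson_bot (I := I) (IsNoetherian.noetherian _)
      (IsLocalRing.maximalIdeal_le_jacobson _) ?_
    conv_lhs => rw [hLv]
    rw [Submodule.span_le]
    rintro _ ⟨j, rfl⟩
    exact hall j
  refine Submodule.span_mono ?_ (hle (memL i))
  rintro _ ⟨j, rfl⟩
  exact ⟨⟨j, by omega⟩, rfl⟩

theorem smith_exists {R : Type*} [CommRing R] [IsDomain R] [IsPrincipalIdealRing R]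
    {n : ℕ} (A : Matrix (Fin n) (Fin n) R) (hA : A.det ≠ 0) :
    ∃ (P Q : Matrix (Fin n) (Fin n) R) (a : Fin n → R), IsUnit P.det ∧ IsUnit Q.det ∧
      (∀ i, a i ≠ 0) ∧ A = P * Matrix.diagonal a * Q := by
  classical
  have hinj : Function.Injective A.mulVecLin := by
    rw [← LinearMap.ker_eq_bot, LinearMap.ker_eq_bot']
    intro v hv
    exact Matrix.eq_zero_of_mulVec_eq_zero hA hv
  let e : (Fin n → R) ≃ₗ[R] LinearMap.range A.mulVecLin := LinearEquiv.ofInjective _ hinj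
  obtain ⟨b', a, ab', h⟩ := Submodule.exists_smith_normal_form_of_rank_eq
    (N := LinearMap.range A.mulVecLin) (Pi.basisFun R (Fin n)) e.symm.finrank_eq
  let E := Pi.basisFun R (Fin n)
  refine ⟨E.toMatrix b', ab'.toMatrix (E.map e), a, ?_, ?_, ?_, ?_⟩
  · have := Module.Basis.toMatrix_mul_toMatrix_flip E b'
    have h2 := congrArg Matrix.det this
    rw [Matrix.det_mul, Matrix.det_one] at h2
    exact IsUnit.of_mul_eq_one _ h2
  · have := Module.Basis.toMatrix_mul_toMatrix_flip ab' (E.map e)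
    have h2 := congrArg Matrix.det this
    rw [Matrix.det_mul, Matrix.det_one] at h2
    exact IsUnit.of_mul_eq_one _ h2
  · intro i hi
    apply ab'.ne_zero i
    apply Subtype.ext
    rw [h, hi]; simp
  · ext r c
    have h3 := ab'.sum_repr (E.map e c)
    have h4 := congrFun (congrArg Subtype.val h3) r
    have h5 : (E.map e c : Fin n → R) r = A r c := by
      simp [e, E, LinearEquiv.ofInjective_apply]
    rw [h5] at h4
    rw [← h4, Matrix.mul_apply, AddSubmonoidClass.coe_finsetSum, Finset.sum_apply]
    refine Finset.sum_congr rfl fun x _ => ?_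
    rw [Submodule.coe_smul, h, Pi.smul_apply, Pi.smul_apply, Matrix.mul_diagonal,
      Module.Basis.toMatrix_apply, Module.Basis.toMatrix_apply]
    simp only [E, Pi.basisFun_repr, smul_eq_mul]
    ring

section Helpers

set_option linter.unusedSectionVars false

variable {p κ}

/-- The vector `y` lies in `p^e W^n`. -/
def InLat {n : ℕ} (e : ℤ) (y : Fin n → K) : Prop :=
  ∀ l, ∃ z : 𝕎, y l = (p : K) ^ e * algebraMap 𝕎 K z

theorem pK_ne : (p : K) ≠ 0 := by
  have h : (algebraMap 𝕎 K) (p : 𝕎) ≠ 0 := by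
    rw [Ne, FaithfulSMul.algebraMap_eq_zero_iff]
    exact WittVector.p_nonzero p κ
  simpa using h

theorem InLat.mono {n : ℕ} {e e' : ℤ} (h : e' ≤ e) {y : Fin n → K} (hy : InLat e y) : InLat e' y := by
  intro l
  obtain ⟨z, hz⟩ := hy l
  obtain ⟨d, rfl⟩ := Int.le.dest h
  refine ⟨(p : 𝕎) ^ d * z, ?_⟩
  rw [hz, zpow_add₀ pK_ne, map_mul, map_pow, map_natCast, zpow_natCast]
  ring

theorem InLat.zero {n : ℕ} (e : ℤ) : InLat e (0 : Fin n → K) := fun _ => ⟨0, by simp⟩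

theorem InLat.add {n : ℕ} {e : ℤ} {y y' : Fin n → K} (hy : InLat e y) (hy' : InLat e y') :
    InLat e (y + y') := by
  intro l
  obtain ⟨z, hz⟩ := hy l
  obtain ⟨z', hz'⟩ := hy' l
  exact ⟨z + z', by rw [Pi.add_apply, hz, hz', map_add]; ring⟩

theorem InLat.smul {n : ℕ} {e : ℤ} {y : Fin n → K} (r : 𝕎) (hy : InLat e y) :
    InLat e (algebraMap 𝕎 K r • y) := by
  intro l
  obtain ⟨z, hz⟩ := hy l
  exact ⟨r * z, by rw [Pi.smul_apply, hz, map_mul, smul_eq_mul]; ring⟩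

theorem InLat.psmul {n : ℕ} {e : ℤ} {y : Fin n → K} (a : ℤ) (hy : InLat e y) :
    InLat (a + e) ((p : K) ^ a • y) := by
  intro l
  obtain ⟨z, hz⟩ := hy l
  exact ⟨z, by rw [Pi.smul_apply, hz, smul_eq_mul, zpow_add₀ pK_ne]; ring⟩

theorem InLat.sum {n : ℕ} {e : ℤ} {ι : Type*} (s : Finset ι) (f : ι → Fin n → K)
    (h : ∀ i ∈ s, InLat e (f i)) : InLat e (∑ i ∈ s, f i) := by
  classical
  induction s using Finset.induction_on with
  | empty => simpa using InLat.zero e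
  | insert a s ha ih =>
    rw [Finset.sum_insert ha]
    exact (h a (by simp)).add (ih fun i hi => h i (by simp [hi]))

theorem InLat.mulVec {n : ℕ} {e : ℤ} {y : Fin n → K} {c : Matrix (Fin n) (Fin n) K}
    (hc : IsIntegralUnit p κ c) (hy : InLat e y) : InLat e (c *ᵥ y) := by
  obtain ⟨d, -, rfl⟩ := hc
  choose z hz using hy
  intro l
  refine ⟨∑ j, d l j * z j, ?_⟩
  simp only [Matrix.mulVec, dotProduct, Matrix.map_apply, hz, map_sum, map_mul, Finset.mul_sum]
  exact Finset.sum_congr rfl fun _ _ => by ring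

theorem IsIntegralUnit.inv {n : ℕ} {c : Matrix (Fin n) (Fin n) K} (hc : IsIntegralUnit p κ c) :
    ∃ c', IsIntegralUnit p κ c' ∧ c' * c = 1 ∧ c * c' = 1 := by
  obtain ⟨d, hd, rfl⟩ := hc
  refine ⟨d⁻¹.map (algebraMap 𝕎 K), ⟨d⁻¹, ?_, rfl⟩, ?_, ?_⟩
  · exact Matrix.isUnit_nonsing_inv_det d hd
  · rw [← Matrix.map_mul, Matrix.nonsing_inv_mul d hd]; simp
  · rw [← Matrix.map_mul, Matrix.mul_nonsing_inv d hd]; simp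

/-- `y` has valuation `a`. -/
def HasVal (y : K) (a : ℤ) : Prop := ∃ u : 𝕎, IsUnit u ∧ y = (p : K) ^ a * algebraMap 𝕎 K u

theorem HasVal.mul {y y' : K} {a a' : ℤ} (h : HasVal y a) (h' : HasVal y' a') :
    HasVal (y * y') (a + a') := by
  obtain ⟨u, hu, rfl⟩ := h
  obtain ⟨u', hu', rfl⟩ := h'
  exact ⟨u * u', hu.mul hu', by rw [zpow_add₀ pK_ne, map_mul]; ring⟩

theorem HasVal.p_zpow (a : ℤ) : HasVal ((p : K) ^ a) a := ⟨1, isUnit_one, by simp⟩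

theorem HasVal.one : HasVal (1 : K) 0 := ⟨1, isUnit_one, by simp⟩

theorem val_le {a b : ℤ} {z u : 𝕎} (hu : IsUnit u)
    (h : (p : K) ^ a * algebraMap 𝕎 K z = (p : K) ^ b * algebraMap 𝕎 K u) : a ≤ b := by
  by_contra hab
  push Not at hab
  obtain ⟨d, hd⟩ := Int.le.dest (Int.add_one_le_of_lt hab)
  have h1 : algebraMap 𝕎 K ((p : 𝕎) * ((p : 𝕎) ^ d * z)) = algebraMap 𝕎 K u := by
    have h2 : (p : K) ^ b ≠ 0 := zpow_ne_zero _ pK_ne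
    apply mul_left_cancel₀ h2
    rw [← h, ← hd, zpow_add₀ pK_ne, zpow_add₀ pK_ne, map_mul, map_mul, map_pow, map_natCast,
      zpow_natCast, zpow_one]
    ring
  have h2 := IsFractionRing.injective 𝕎 K h1
  exact (WittVector.irreducible p (k := κ)).not_isUnit (isUnit_of_mul_isUnit_left (h2 ▸ hu))

theorem HasVal.unique {y : K} {a b : ℤ} (h : HasVal y a) (h' : HasVal y b) : a = b := by
  obtain ⟨u, hu, rfl⟩ := h
  obtain ⟨u', hu', h2⟩ := h'
  exact le_antisymm (val_le hu' h2) (val_le hu h2.symm)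

theorem HasVal.inv {y : K} {a : ℤ} (h : HasVal y a) : HasVal y⁻¹ (-a) := by
  obtain ⟨u, ⟨v, rfl⟩, rfl⟩ := h
  refine ⟨↑v⁻¹, v⁻¹.isUnit, inv_eq_of_mul_eq_one_right ?_⟩
  have h1 : algebraMap 𝕎 K ↑v * algebraMap 𝕎 K ↑v⁻¹ = 1 := by
    rw [← map_mul, Units.mul_inv, map_one]
  have h2 : (p : K) ^ a * (p : K) ^ (-a) = 1 := by
    rw [← zpow_add₀ pK_ne, add_neg_cancel, zpow_zero]
  calc _ = ((p : K) ^ a * (p : K) ^ (-a)) * (algebraMap 𝕎 K ↑v * algebraMap 𝕎 K ↑v⁻¹) := by ring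
    _ = 1 := by rw [h1, h2, one_mul]

theorem HasVal.of_int {r : 𝕎} (hr : r ≠ 0) : ∃ a, HasVal (algebraMap 𝕎 K r) a := by
  obtain ⟨m, u, rfl⟩ := WittVector.exists_eq_pow_p_mul' r hr
  exact ⟨m, u, u.isUnit, by rw [map_mul, map_pow, map_natCast, zpow_natCast]⟩

theorem HasVal.prod {n : ℕ} (f : Fin n → K) (a : Fin n → ℤ) (h : ∀ i, HasVal (f i) (a i)) :
    HasVal (∏ i, f i) (∑ i, a i) := by
  induction n with
  | zero => simpa using HasVal.one
  | succ n ih =>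
    rw [Fin.prod_univ_succ, Fin.sum_univ_succ]
    exact (h 0).mul (ih _ _ fun i => h i.succ)

theorem HasVal.ex {y : K} (hy : y ≠ 0) : ∃ a, HasVal y a := by
  obtain ⟨r, s, hs, rfl⟩ := IsFractionRing.div_surjective (A := 𝕎) y
  have hs0 : s ≠ 0 := nonZeroDivisors.ne_zero hs
  have hr0 : r ≠ 0 := by rintro rfl; exact hy (by rw [map_zero, zero_div])
  obtain ⟨a, ha⟩ := HasVal.of_int hr0
  obtain ⟨a', ha'⟩ := HasVal.of_int hs0
  rw [div_eq_mul_inv]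
  exact ⟨_, ha.mul ha'.inv⟩

theorem InLat.val_le {n : ℕ} {e a : ℤ} {y : Fin n → K} (h : InLat e y) (l : Fin n)
    (ha : HasVal (y l) a) : e ≤ a := by
  obtain ⟨z, hz⟩ := h l
  obtain ⟨u, hu, hy⟩ := ha
  exact _root_.val_le hu (hz.symm.trans hy)

theorem InLat.ex {n : ℕ} (y : Fin n → K) : ∃ e, InLat e y := by
  have h1 : ∀ l, ∃ e : ℤ, ∃ z : 𝕎, y l = (p : K) ^ e * algebraMap 𝕎 K z := by
    intro l
    by_cases h : y l = 0
    · exact ⟨0, 0, by simp [h]⟩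
    · obtain ⟨a, u, -, hu⟩ := HasVal.ex h
      exact ⟨a, u, hu⟩
  choose e he using h1
  obtain ⟨e0, he0⟩ := (Set.finite_range e).bddBelow
  refine ⟨e0, fun l => ?_⟩
  have h3 : InLat (n := 1) (e l) (fun _ => y l) := fun _ => he l
  exact h3.mono (he0 ⟨l, rfl⟩) 0

theorem InLat.prim {n : ℕ} {y : Fin n → K} (hy : y ≠ 0) :
    ∃ a : ℤ, InLat 0 ((p : K) ^ a • y) ∧ ¬ InLat 1 ((p : K) ^ a • y) := by
  obtain ⟨l, hl⟩ := Function.ne_iff.mp hy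
  obtain ⟨v, hv⟩ := HasVal.ex (p := p) (κ := κ) hl
  obtain ⟨e, he, hmax⟩ := Int.exists_greatest_of_bdd (P := fun e => InLat e y)
    ⟨v, fun e he => he.val_le l hv⟩ (InLat.ex y)
  refine ⟨-e, by simpa using he.psmul (-e), fun h => ?_⟩
  have h2 := h.psmul e
  rw [smul_smul, ← zpow_add₀ pK_ne, add_neg_cancel, zpow_zero, one_smul] at h2
  have := hmax _ h2
  omega

/-- Frobenius compatibility of `σ`. -/
def IsFrob (σ : K ≃+* K) : Prop :=
  ∀ x : 𝕎, σ (algebraMap 𝕎 K x) = algebraMap 𝕎 K (WittVector.frobenius x)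

theorem sigma_p (σ : K ≃+* K) (a : ℤ) : σ ((p : K) ^ a) = (p : K) ^ a := by
  rw [map_zpow₀, map_natCast]

theorem frob_isUnit {u : 𝕎} : IsUnit (WittVector.frobenius u) ↔ IsUnit u := by
  have := MulEquiv.isUnit_map (WittVector.frobeniusEquiv p κ) (x := u)
  simpa using this

theorem HasVal.sigma {σ : K ≃+* K} (hσ : IsFrob σ) {y : K} {a : ℤ} (h : HasVal y a) :
    HasVal (σ y) a := by
  obtain ⟨u, hu, rfl⟩ := h
  exact ⟨WittVector.frobenius u, frob_isUnit.mpr hu, by rw [map_mul, sigma_p, hσ]⟩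

theorem HasVal.sigma_iter {σ : K ≃+* K} (hσ : IsFrob σ) {y : K} {a : ℤ} (h : HasVal y a) (i : ℕ) :
    HasVal (σ^[i] y) a := by
  induction i with
  | zero => exact h
  | succ i ih => rw [Function.iterate_succ_apply']; exact ih.sigma hσ

theorem InLat.sigma {σ : K ≃+* K} (hσ : IsFrob σ) {n : ℕ} {e : ℤ} {y : Fin n → K} (h : InLat e y) :
    InLat e (fun l => σ (y l)) := by
  intro l
  obtain ⟨z, hz⟩ := h l
  exact ⟨WittVector.frobenius z, by simp only [hz, map_mul, sigma_p, hσ z]⟩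

theorem InLat.of_sigma {σ : K ≃+* K} (hσ : IsFrob σ) {n : ℕ} {e : ℤ} {y : Fin n → K}
    (h : InLat e (fun l => σ (y l))) : InLat e y := by
  intro l
  obtain ⟨z, hz⟩ := h l
  obtain ⟨w, rfl⟩ := (WittVector.frobeniusEquiv p κ).surjective z
  refine ⟨w, σ.injective ?_⟩
  rw [map_mul, sigma_p, hσ w]; exact hz

theorem InLat.of_sigma_iter {σ : K ≃+* K} (hσ : IsFrob σ) {n : ℕ} {e : ℤ} {y : Fin n → K} (i : ℕ)
    (h : InLat e (fun l => σ^[i] (y l))) : InLat e y := by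
  induction i with
  | zero => exact h
  | succ i ih =>
    simp only [Function.iterate_succ_apply'] at h
    exact ih (InLat.of_sigma hσ h)

theorem IsIntegralUnit.det {n : ℕ} {c : Matrix (Fin n) (Fin n) K} (hc : IsIntegralUnit p κ c) :
    HasVal c.det 0 := by
  obtain ⟨d, hd, rfl⟩ := hc
  refine ⟨d.det, hd, ?_⟩
  rw [zpow_zero, one_mul, RingHom.map_det]; rfl

theorem IsHodgePoint.det {n : ℕ} {b : Matrix (Fin n) (Fin n) K} {μ : Fin n → ℤ}
    (h : IsHodgePoint p κ b μ) : HasVal b.det (∑ l, μ l) := by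
  obtain ⟨-, c₁, c₂, h1, h2, rfl⟩ := h
  rw [Matrix.det_mul, Matrix.det_mul, Matrix.det_diagonal]
  have h3 : HasVal (∏ i, (p : K) ^ μ i) (∑ l, μ l) :=
    HasVal.prod _ _ fun i => HasVal.p_zpow _
  simpa using (h1.det.mul h3).mul h2.det

end Helpers

section Helpers2

set_option linter.unusedSectionVars false

variable {p κ}

/-- The semilinear operator `bσ`. -/
def Phi {n : ℕ} (σ : K ≃+* K) (b : Matrix (Fin n) (Fin n) K) (v : Fin n → K) : Fin n → K :=
  b *ᵥ (fun l => σ (v l))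

theorem iter_eq (σ : K ≃+* K) (k : ℕ) : σ^[k] = ⇑((σ : K →+* K) ^ k) := by
  rw [RingHom.coe_pow]; rfl

theorem Phi_iter {n : ℕ} (σ : K ≃+* K) (b : Matrix (Fin n) (Fin n) K) (v : Fin n → K) (i : ℕ) :
    (Phi σ b)^[i] v = twistedPow p κ σ b i *ᵥ (fun l => σ^[i] (v l)) := by
  induction i with
  | zero => simp [twistedPow]
  | succ i ih =>
    rw [Function.iterate_succ_apply', ih, Phi, twistedPow, ← Matrix.mulVec_mulVec]
    congr 1
    ext l
    have := RingHom.map_mulVec (σ : K →+* K) (twistedPow p κ σ b i) (fun l => σ^[i] (v l)) l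
    simp only [Function.iterate_succ_apply']
    exact this

theorem det_map_sigma {n : ℕ} (σ : K ≃+* K) (b : Matrix (Fin n) (Fin n) K) :
    (b.map σ).det = σ b.det :=
  ((σ : K →+* K).map_det b).symm

theorem det_map_iter {n : ℕ} (σ : K ≃+* K) (b : Matrix (Fin n) (Fin n) K) (k : ℕ) :
    (b.map σ^[k]).det = σ^[k] b.det := by
  rw [iter_eq]
  exact (((σ : K →+* K) ^ k).map_det b).symm

theorem twistedPow_det {n : ℕ} {σ : K ≃+* K} (hσ : IsFrob σ) {b : Matrix (Fin n) (Fin n) K} {s : ℤ}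
    (h : HasVal b.det s) (i : ℕ) : HasVal (twistedPow p κ σ b i).det (i * s) := by
  induction i with
  | zero => simpa [twistedPow] using HasVal.one
  | succ i ih =>
    rw [twistedPow, Matrix.det_mul, det_map_sigma]
    have := h.mul (ih.sigma hσ)
    convert this using 1
    push_cast; ring

theorem twistedPow_conj {n : ℕ} (σ : K ≃+* K) {b g B : Matrix (Fin n) (Fin n) K}
    (hg : IsUnit g.det) (hb : b = g⁻¹ * B * g.map σ) (i : ℕ) :
    twistedPow p κ σ b i = g⁻¹ * twistedPow p κ σ B i * g.map σ^[i] := by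
  induction i with
  | zero => simp [twistedPow, Matrix.nonsing_inv_mul g hg]
  | succ i ih =>
    have h1 : g.map σ * (g⁻¹).map σ = 1 := by
      rw [← Matrix.map_mul, Matrix.mul_nonsing_inv g hg]; simp
    have h2 : (g.map σ^[i]).map σ = g.map σ^[i+1] := by
      ext r c; simp only [Matrix.map_apply, Function.iterate_succ_apply']
    rw [twistedPow, ih, twistedPow, Matrix.map_mul, Matrix.map_mul, h2]
    conv_lhs => rw [hb]
    calc _ = g⁻¹ * B * (g.map σ * (g⁻¹).map σ) * (twistedPow p κ σ B i).map σ * g.map σ^[i+1] := by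
          simp only [Matrix.mul_assoc]
      _ = _ := by rw [h1]; simp only [Matrix.mul_assoc, Matrix.mul_one]

theorem twistedPow_fixed {n : ℕ} (σ : K ≃+* K) {B : Matrix (Fin n) (Fin n) K}
    (hB : B.map σ = B) (i : ℕ) : twistedPow p κ σ B i = B ^ i := by
  have h : ∀ i, (B ^ i).map σ = B ^ i := by
    intro i
    induction i with
    | zero => simp
    | succ i ih => rw [pow_succ, Matrix.map_mul, ih, hB]
  induction i with
  | zero => simp [twistedPow]
  | succ i ih => rw [twistedPow, ih, h, pow_succ']

theorem Phi_lat {n : ℕ} {σ : K ≃+* K} (hσ : IsFrob σ) {b : Matrix (Fin n) (Fin n) K}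
    {μ : Fin n → ℤ} (hb : IsHodgePoint p κ b μ) {c : ℤ} (hc : ∀ l, c ≤ μ l) {e : ℤ}
    {v : Fin n → K} (hv : InLat e v) : InLat (e + c) (Phi σ b v) := by
  obtain ⟨-, c₁, c₂, h1, h2, rfl⟩ := hb
  rw [Phi, ← Matrix.mulVec_mulVec, ← Matrix.mulVec_mulVec]
  refine InLat.mulVec h1 fun l => ?_
  have h3 : InLat (n := 1) (μ l + e) ((p : K) ^ μ l • fun _ => (c₂ *ᵥ fun l => σ (v l)) l) :=
    InLat.psmul _ fun _ => InLat.mulVec h2 (hv.sigma hσ) l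
  have h4 := h3.mono (e' := e + c) (by linarith [hc l]) 0
  rw [Matrix.mulVec_diagonal]
  exact h4

theorem Phi_iter_lat {n : ℕ} {σ : K ≃+* K} (hσ : IsFrob σ) {b : Matrix (Fin n) (Fin n) K}
    {μ : Fin n → ℤ} (hb : IsHodgePoint p κ b μ) {c : ℤ} (hc : ∀ l, c ≤ μ l) {e : ℤ}
    {v : Fin n → K} (hv : InLat e v) (k : ℕ) : InLat (e + k * c) ((Phi σ b)^[k] v) := by
  induction k with
  | zero => simpa using hv
  | succ k ih =>
    rw [Function.iterate_succ_apply']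
    have := Phi_lat hσ hb hc ih
    convert this using 1
    push_cast; ring

theorem sigma_iter_algebraMap {σ : K ≃+* K} (hσ : IsFrob σ) (k : ℕ) (z : 𝕎) :
    σ^[k] (algebraMap 𝕎 K z) = algebraMap 𝕎 K ((WittVector.frobenius : 𝕎 →+* 𝕎)^[k] z) := by
  induction k with
  | zero => rfl
  | succ k ih => rw [Function.iterate_succ_apply', ih, hσ, Function.iterate_succ_apply']

theorem sigma_iter_p (σ : K ≃+* K) (k : ℕ) (a : ℤ) : σ^[k] ((p : K) ^ a) = (p : K) ^ a := by
  rw [iter_eq, map_zpow₀, map_natCast]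

theorem core_int {n : ℕ} (m : ℕ) (x : Fin n → ℤ) (t : Fin n) (u : Fin n → 𝕎) (i : ℕ) :
    ∃ r : Fin n → 𝕎, ∀ l, (p : 𝕎) ^ (i * (x l - x t).toNat) *
        (WittVector.frobenius : 𝕎 →+* 𝕎)^[m * i] (u l) =
      ∑ j : Fin n, r j * ((p : 𝕎) ^ (j * (x l - x t).toNat) *
        (WittVector.frobenius : 𝕎 →+* 𝕎)^[m * j] (u l)) := by
  let τ : 𝕎 →+* 𝕎 := (WittVector.frobenius : 𝕎 →+* 𝕎) ^ m
  have hτ' : ⇑τ = (WittVector.frobenius : 𝕎 →+* 𝕎)^[m] := RingHom.coe_pow _ _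
  have hu : ∀ k : ℕ, ∀ r : 𝕎, IsUnit ((WittVector.frobenius : 𝕎 →+* 𝕎)^[k] r) → IsUnit r := by
    intro k
    induction k with
    | zero => exact fun r h => h
    | succ k ih =>
      intro r h
      rw [Function.iterate_succ_apply'] at h
      exact ih _ (frob_isUnit.mp h)
  let Ψ : (Fin n → 𝕎) → (Fin n → 𝕎) := fun u l => (p : 𝕎) ^ (x l - x t).toNat * τ (u l)
  have hiter : ∀ (i : ℕ) (l : Fin n), Ψ^[i] u l = (p : 𝕎) ^ (i * (x l - x t).toNat) *
        (WittVector.frobenius : 𝕎 →+* 𝕎)^[m * i] (u l) := by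
    intro i l
    induction i with
    | zero => simp
    | succ i ih =>
      rw [Function.iterate_succ_apply']
      change (p : 𝕎) ^ (x l - x t).toNat * τ (Ψ^[i] u l) = _
      rw [ih, map_mul, map_pow, map_natCast, hτ', ← Function.iterate_add_apply, ← mul_assoc,
        ← pow_add, show m * (i + 1) = m + m * i by ring, Nat.add_mul, Nat.one_mul,
        Nat.add_comm (x l - x t).toNat]
  have h := core_span n τ (fun r hr => by
      rw [IsLocalRing.mem_maximalIdeal, mem_nonunits_iff] at hr ⊢
      rw [hτ']
      exact fun h => hr (hu m r h)) Ψ (fun u v => by ext1 l; simp [Ψ, mul_add])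
      (fun r v => by ext1 l; simp only [Ψ, Pi.smul_apply, smul_eq_mul, map_mul]; ring) u i
  rw [Submodule.mem_span_range_iff_exists_fun] at h
  obtain ⟨r, hr⟩ := h
  refine ⟨r, fun l => ?_⟩
  rw [← hiter, ← hr, Finset.sum_apply]
  exact Finset.sum_congr rfl fun j _ => by rw [Pi.smul_apply, smul_eq_mul, hiter]

theorem core_K {σ : K ≃+* K} (hσ : IsFrob σ) {n : ℕ} (m : ℕ) (x : Fin n → ℤ) (t : Fin n)
    (u : Fin n → K) (hu : ∀ l, u l ≠ 0 → x t ≤ x l) (i : ℕ) :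
    ∃ r : Fin n → 𝕎, ∀ l, (p : K) ^ (i * x l) * σ^[m * i] (u l) =
      ∑ j : Fin n, algebraMap 𝕎 K (r j) * (p : K) ^ (((i : ℤ) - (j : ℕ)) * x t) *
        ((p : K) ^ ((j : ℕ) * x l) * σ^[m * j] (u l)) := by
  obtain ⟨e, he⟩ := InLat.ex u
  choose z hz using he
  obtain ⟨r, hr⟩ := core_int m x t z i
  refine ⟨r, fun l => ?_⟩
  by_cases h0 : u l = 0
  · have : ∀ k, σ^[k] (0 : K) = 0 := fun k => by rw [iter_eq, map_zero]
    simp [h0, this]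
  · have hx := hu l h0
    have hpow : ∀ j : ℕ, algebraMap 𝕎 K ((p : 𝕎) ^ (j * (x l - x t).toNat)) =
        (p : K) ^ (j * x l) * (p : K) ^ (-(j * x t)) := by
      intro j
      rw [map_pow, map_natCast, ← zpow_natCast, ← zpow_add₀ pK_ne]
      congr 1
      push_cast
      rw [Int.toNat_of_nonneg (by omega)]
      ring
    have hs : ∀ k, σ^[k] (u l) = (p : K) ^ e * algebraMap 𝕎 K
        ((WittVector.frobenius : 𝕎 →+* 𝕎)^[k] (z l)) := by
      intro k
      rw [hz l, ← sigma_iter_algebraMap hσ]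
      conv_rhs => rw [← sigma_iter_p σ k e]
      rw [iter_eq, map_mul]
    have h1 := congrArg (algebraMap 𝕎 K) (hr l)
    rw [map_mul, map_sum, hpow] at h1
    have h2 : (p : K) ^ (i * x l) * σ^[m * i] (u l) = (p : K) ^ e * (p : K) ^ (i * x t) *
        ((p : K) ^ (i * x l) * (p : K) ^ (-(i * x t)) *
          algebraMap 𝕎 K ((WittVector.frobenius : 𝕎 →+* 𝕎)^[m * i] (z l))) := by
      have h3 : (p : K) ^ ((i : ℤ) * x t) * (p : K) ^ (-((i : ℤ) * x t)) = 1 := by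
        rw [← zpow_add₀ pK_ne, add_neg_cancel, zpow_zero]
      rw [hs]
      linear_combination (-(p : K) ^ ((i : ℤ) * x l) * (p : K) ^ e * algebraMap 𝕎 K
        ((WittVector.frobenius : 𝕎 →+* 𝕎)^[m * i] (z l))) * h3
    rw [h2, h1, Finset.mul_sum]
    refine Finset.sum_congr rfl fun j _ => ?_
    rw [map_mul, map_mul, hpow, hs, sub_mul, sub_eq_add_neg, zpow_add₀ pK_ne]
    ring

end Helpers2

section Helpers3

set_option linter.unusedSectionVars false

variable {p κ}

theorem Phi_formula {σ : K ≃+* K} {n : ℕ} {b g : Matrix (Fin n) (Fin n) K}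
    (hg : IsUnit g.det) (m : ℕ) (x : Fin n → ℤ)
    (H : ∀ i : ℕ, twistedPow p κ σ b (m * i) =
      g⁻¹ * Matrix.diagonal (fun l => (p : K) ^ (i * x l)) * g.map σ^[m * i])
    (i : ℕ) (u : Fin n → K) :
    (Phi σ b)^[m * i] (g⁻¹ *ᵥ u) =
      g⁻¹ *ᵥ (fun l => (p : K) ^ (i * x l) * σ^[m * i] (u l)) := by
  rw [Phi_iter, H]
  have h1 : (fun l => σ^[m * i] ((g⁻¹ *ᵥ u) l)) =
      (g⁻¹).map σ^[m * i] *ᵥ (fun l => σ^[m * i] (u l)) := by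
    ext l
    rw [iter_eq]
    exact RingHom.map_mulVec _ _ _ _
  have h2 : g.map σ^[m * i] * (g⁻¹).map σ^[m * i] = 1 := by
    rw [iter_eq, ← Matrix.map_mul, Matrix.mul_nonsing_inv g hg]; simp
  rw [h1, Matrix.mulVec_mulVec, Matrix.mul_assoc, h2, Matrix.mul_one, ← Matrix.mulVec_mulVec]
  congr 1
  ext l
  rw [Matrix.mulVec_diagonal]

theorem inv_mulVec_ne {n : ℕ} {g : Matrix (Fin n) (Fin n) K}
    (hg : IsUnit g.det) {u : Fin n → K} (hu : u ≠ 0) : g⁻¹ *ᵥ u ≠ 0 := by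
  intro h
  apply hu
  have := congrArg (fun v => g *ᵥ v) h
  simpa [Matrix.mulVec_mulVec, Matrix.mul_nonsing_inv g hg] using this

theorem slope_ge {σ : K ≃+* K} (hσ : IsFrob σ) {n : ℕ} {b g : Matrix (Fin n) (Fin n) K}
    (hg : IsUnit g.det) (m : ℕ) (x : Fin n → ℤ)
    (H : ∀ i : ℕ, twistedPow p κ σ b (m * i) =
      g⁻¹ * Matrix.diagonal (fun l => (p : K) ^ (i * x l)) * g.map σ^[m * i])
    {μ₁ : Fin n → ℤ} (hb : IsHodgePoint p κ b μ₁) {c : ℤ} (hc : ∀ l, c ≤ μ₁ l) (t : Fin n) :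
    m * c ≤ x t := by
  classical
  have hy : g⁻¹ *ᵥ (Pi.single t (1 : K)) ≠ 0 := inv_mulVec_ne hg (by simp)
  obtain ⟨a, ha0, ha1⟩ := InLat.prim hy
  rw [← Matrix.mulVec_smul] at ha0 ha1
  have h1 := Phi_iter_lat hσ hb hc ha0 (m * 1)
  rw [Phi_formula hg m x H] at h1
  have h2 : (fun l => (p : K) ^ (((1 : ℕ) : ℤ) * x l) *
      σ^[m * 1] (((p : K) ^ a • (Pi.single t (1 : K) : Fin n → K)) l)) =
      (p : K) ^ (x t) • ((p : K) ^ a • (Pi.single t (1 : K) : Fin n → K)) := by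
    ext l
    by_cases hl : l = t
    · subst hl
      simp [sigma_iter_p]
    · have : σ^[m * 1] (0 : K) = 0 := by rw [iter_eq, map_zero]
      simp only [Pi.smul_apply, Pi.single_eq_of_ne hl, smul_zero, this, mul_zero]
  rw [h2, Matrix.mulVec_smul] at h1
  have h3 := h1.psmul (-(x t))
  rw [smul_smul, ← zpow_add₀ pK_ne, neg_add_cancel, zpow_zero, one_smul] at h3
  by_contra hlt
  push Not at hlt
  refine ha1 (h3.mono ?_)
  push_cast
  linarith

theorem exists_kernel {F : Type*} [Field F] {n : ℕ} (Q : Matrix (Fin n) (Fin n) F) (t : Fin n) :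
    ∃ w : Fin n → F, w ≠ 0 ∧ (∀ l, t < l → w l = 0) ∧ (∀ l, l < t → (Q *ᵥ w) l = 0) := by
  classical
  let f : (Fin n → F) →ₗ[F] (Fin n → F) := LinearMap.pi fun l =>
    if l < t then (LinearMap.proj l).comp Q.mulVecLin else if t < l then LinearMap.proj l else 0
  have hns : ¬ Function.Surjective f := by
    intro h
    obtain ⟨w, hw⟩ := h (Pi.single t 1)
    have := congrFun hw t
    simp [f] at this
  have hni : ¬ Function.Injective f := fun h => hns (LinearMap.injective_iff_surjective.mp h)
  rw [← LinearMap.ker_eq_bot, LinearMap.ker_eq_bot'] at hni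
  push Not at hni
  obtain ⟨w, hw, hw0⟩ := hni
  refine ⟨w, hw0, fun l hl => ?_, fun l hl => ?_⟩
  · have := congrFun hw l
    simpa [f, hl, hl.not_gt] using this
  · have := congrFun hw l
    simpa [f, hl] using this

theorem hodge_lower {σ : K ≃+* K} (hσ : IsFrob σ) {n : ℕ} {b g : Matrix (Fin n) (Fin n) K}
    (hg : IsUnit g.det) (m : ℕ) (x : Fin n → ℤ) (hx : Antitone x)
    (H : ∀ i : ℕ, twistedPow p κ σ b (m * i) =
      g⁻¹ * Matrix.diagonal (fun l => (p : K) ^ (i * x l)) * g.map σ^[m * i])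
    {μ₁ : Fin n → ℤ} (hb : IsHodgePoint p κ b μ₁) {c : ℤ} (hc : ∀ l, c ≤ μ₁ l)
    (i : ℕ) {μ : Fin n → ℤ} (hμ : IsHodgePoint p κ (twistedPow p κ σ b (m * i)) μ) (t : Fin n) :
    i * x t - n * (x t - m * c) ≤ μ t := by
  have hge := slope_ge hσ hg m x H hb hc t
  obtain ⟨hanti, c₁, c₂, h1, h2, hdec⟩ := hμ
  by_contra hlt
  push Not at hlt
  set E : ℤ := i * x t - n * (x t - m * c) with hE
  -- the kernel vector
  obtain ⟨w, hw0, hwt, hwQ⟩ := exists_kernel (c₂ * (g⁻¹).map σ^[m * i]) t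
  have hsurj : Function.Surjective (σ^[m * i]) := σ.surjective.iterate _
  choose u0 hu0 using fun l => hsurj (w l)
  have hu0t : ∀ l, t < l → u0 l = 0 := by
    intro l hl
    apply (σ.injective.iterate (m * i))
    rw [hu0, hwt l hl, iter_eq, map_zero]
  obtain ⟨c₂', hc₂', hcc, -⟩ := h2.inv
  obtain ⟨c₁', hc₁', hcc1, -⟩ := h1.inv
  have hmap : ∀ u : Fin n → K, (fun l => σ^[m * i] ((g⁻¹ *ᵥ u) l)) =
      (g⁻¹).map σ^[m * i] *ᵥ (fun l => σ^[m * i] (u l)) := by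
    intro u
    ext l
    rw [iter_eq]
    exact RingHom.map_mulVec _ _ _ _
  have hginv : g.map σ^[m * i] * (g⁻¹).map σ^[m * i] = 1 := by
    rw [iter_eq, ← Matrix.map_mul, Matrix.mul_nonsing_inv g hg]; simp
  have hz0 : (c₂ * (g⁻¹).map σ^[m * i]) *ᵥ w ≠ 0 := by
    intro h
    apply hw0
    have := congrArg (fun v => (g.map σ^[m * i] * c₂') *ᵥ v) h
    simp only [Matrix.mulVec_mulVec, Matrix.mulVec_zero] at this
    rw [Matrix.mul_assoc, ← Matrix.mul_assoc c₂', hcc, Matrix.one_mul, hginv, Matrix.one_mulVec]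
      at this
    exact this
  obtain ⟨a, ha0, ha1⟩ := InLat.prim hz0
  set z := (p : K) ^ a • ((c₂ * (g⁻¹).map σ^[m * i]) *ᵥ w) with hz
  set u : Fin n → K := (p : K) ^ a • u0 with hu
  have hzu : z = c₂ *ᵥ (fun l => σ^[m * i] ((g⁻¹ *ᵥ u) l)) := by
    rw [hmap, Matrix.mulVec_mulVec, hz, ← Matrix.mulVec_smul]
    congr 1
    ext l
    rw [hu, Pi.smul_apply, Pi.smul_apply, ← hu0, smul_eq_mul, smul_eq_mul]
    conv_lhs => rw [← sigma_iter_p σ (m * i) a]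
    rw [iter_eq, map_mul]
  have hv : InLat 0 (g⁻¹ *ᵥ u) := by
    apply InLat.of_sigma_iter hσ (m * i)
    have := ha0.mulVec hc₂'
    rwa [hzu, Matrix.mulVec_mulVec, hcc, Matrix.one_mulVec] at this
  have hut : ∀ l, u l ≠ 0 → x t ≤ x l := by
    intro l hl
    apply hx
    by_contra hlt
    push Not at hlt
    exact hl (by rw [hu, Pi.smul_apply, hu0t l hlt, smul_zero])
  -- main estimate
  have hmain : InLat E ((Phi σ b)^[m * i] (g⁻¹ *ᵥ u)) := by
    obtain ⟨r, hr⟩ := core_K hσ m x t u hut i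
    have h3 : (Phi σ b)^[m * i] (g⁻¹ *ᵥ u) = ∑ j : Fin n, algebraMap 𝕎 K (r j) •
        ((p : K) ^ (((i : ℤ) - (j : ℕ)) * x t) • (Phi σ b)^[m * j] (g⁻¹ *ᵥ u)) := by
      simp only [Phi_formula hg m x H, ← Matrix.mulVec_smul]
      rw [← Matrix.mulVec_sum]
      congr 1
      ext l
      rw [hr l, Finset.sum_apply]
      exact Finset.sum_congr rfl fun j _ => by
        simp only [Pi.smul_apply, smul_eq_mul, mul_assoc]
    rw [h3]
    refine InLat.sum _ _ fun j _ => InLat.smul _ ?_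
    refine ((Phi_iter_lat hσ hb hc hv (m * j)).psmul _).mono ?_
    have hj : ((j : ℕ) : ℤ) ≤ n := by exact_mod_cast j.2.le
    rw [hE]
    push_cast
    nlinarith
  rw [Phi_iter, hdec, ← Matrix.mulVec_mulVec, ← hzu, ← Matrix.mulVec_mulVec] at hmain
  have hD := hmain.mulVec hc₁'
  rw [Matrix.mulVec_mulVec, hcc1, Matrix.one_mulVec] at hD
  apply ha1
  intro l
  rcases lt_or_ge l t with hl | hl
  · exact ⟨0, by rw [hz, Pi.smul_apply, hwQ l hl]; simp⟩
  · have hl2 := hD l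
    rw [Matrix.mulVec_diagonal] at hl2
    have h5 : InLat (n := 1) E (fun _ => (p : K) ^ μ l * z l) := fun _ => hl2
    have h6 := h5.psmul (-(μ l))
    have h7 := hanti hl
    have h8 := h6.mono (e' := 1) (by linarith) 0
    have h9 : ((p : K) ^ (-μ l) • (fun _ : Fin 1 => (p : K) ^ μ l * z l)) 0 = z l := by
      rw [Pi.smul_apply, smul_eq_mul, ← mul_assoc, ← zpow_add₀ pK_ne, neg_add_cancel, zpow_zero,
        one_mul]
    rw [h9] at h8
    exact h8

theorem hodge_exists {n : ℕ} (B : Matrix (Fin n) (Fin n) K) (hB : B.det ≠ 0) :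
    ∃ μ, IsHodgePoint p κ B μ := by
  classical
  -- clear denominators
  obtain ⟨e, he⟩ := InLat.ex (n := n * n) (fun q => B (finProdFinEquiv.symm q).1
    (finProdFinEquiv.symm q).2)
  have he' : ∀ r c, ∃ z : 𝕎, B r c = (p : K) ^ e * algebraMap 𝕎 K z := by
    intro r c
    have := he (finProdFinEquiv (r, c))
    simpa using this
  choose A hA using he'
  have hBA : B = (p : K) ^ e • (Matrix.of A).map (algebraMap 𝕎 K) := by
    ext r c; simp [hA]
  have hAdet : (Matrix.of A).det ≠ 0 := by
    intro h
    apply hB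
    rw [hBA, Matrix.det_smul]
    have : ((Matrix.of A).map (algebraMap 𝕎 K)).det = algebraMap 𝕎 K (Matrix.of A).det :=
      ((algebraMap 𝕎 K).map_det _).symm
    rw [this, h, map_zero, mul_zero]
  obtain ⟨P, Q, a, hP, hQ, ha, hPQ⟩ := smith_exists _ hAdet
  choose k v hkv using fun l => WittVector.exists_eq_pow_p_mul' (a l) (ha l)
  let ρ : Equiv.Perm (Fin n) := Tuple.sort (fun l => -((k l : ℤ)))
  have hρ : Monotone ((fun l => -((k l : ℤ))) ∘ ρ) := Tuple.monotone_sort _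
  refine ⟨fun l => e + k (ρ l), fun i j hij => ?_, P.map (algebraMap 𝕎 K) *
    ((ρ.permMatrix 𝕎)ᵀ).map (algebraMap 𝕎 K),
    (ρ.permMatrix 𝕎).map (algebraMap 𝕎 K) *
      (Matrix.diagonal fun l => (v l : 𝕎)).map (algebraMap 𝕎 K) * Q.map (algebraMap 𝕎 K),
    ?_, ?_, ?_⟩
  · have := hρ hij
    simp only [Function.comp_apply] at this
    linarith
  · refine ⟨P * (ρ.permMatrix 𝕎)ᵀ, ?_, by rw [Matrix.map_mul]⟩
    rw [Matrix.det_mul, Matrix.det_transpose, Matrix.det_permutation]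
    exact hP.mul ((Equiv.Perm.sign ρ).isUnit.map (Int.castRingHom 𝕎))
  · refine ⟨ρ.permMatrix 𝕎 * (Matrix.diagonal fun l => (v l : 𝕎)) * Q, ?_, by
      rw [Matrix.map_mul, Matrix.map_mul]⟩
    rw [Matrix.det_mul, Matrix.det_mul, Matrix.det_permutation, Matrix.det_diagonal]
    refine (((Equiv.Perm.sign ρ).isUnit.map (Int.castRingHom 𝕎)).mul ?_).mul hQ
    exact IsUnit.prod_univ_iff.mpr fun l => (v l).isUnit
  · rw [hBA, hPQ]
    have h1 : ((ρ.permMatrix 𝕎)ᵀ).map (algebraMap 𝕎 K) *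
        Matrix.diagonal (fun l => (p : K) ^ (e + (k (ρ l) : ℤ))) *
        (ρ.permMatrix 𝕎).map (algebraMap 𝕎 K) =
        Matrix.diagonal (fun l => (p : K) ^ (e + (k l : ℤ))) := by
      ext r c
      rw [Matrix.mul_apply, Matrix.diagonal_apply]
      simp only [Matrix.mul_diagonal, Matrix.map_apply, Matrix.transpose_apply,
        Equiv.Perm.permMatrix, PEquiv.toMatrix_apply, Equiv.toPEquiv_apply, Option.mem_def,
        Option.some.injEq]
      rw [Finset.sum_eq_single (ρ.symm r)]
      · by_cases h : r = c <;> simp [h]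
      · intro l _ hl
        have : ρ l ≠ r := fun h => hl (by rw [← h]; simp)
        simp [this]
      · simp
    have h2 : (Matrix.diagonal a).map (algebraMap 𝕎 K) =
        Matrix.diagonal (fun l => (p : K) ^ (k l : ℤ)) *
        (Matrix.diagonal fun l => (v l : 𝕎)).map (algebraMap 𝕎 K) := by
      rw [Matrix.diagonal_map (map_zero _), Matrix.diagonal_map (map_zero _),
        Matrix.diagonal_mul_diagonal]
      congr 1
      ext l
      conv_lhs => rw [hkv l]
      rw [map_mul, map_pow, map_natCast, zpow_natCast]
    have h3 : Matrix.diagonal (fun l => (p : K) ^ (e + (k l : ℤ))) =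
        (p : K) ^ e • Matrix.diagonal (fun l => (p : K) ^ (k l : ℤ)) := by
      rw [← Matrix.diagonal_smul]
      congr 1
      ext l
      rw [Pi.smul_apply, smul_eq_mul, zpow_add₀ pK_ne]
    rw [Matrix.map_mul, Matrix.map_mul, h2]
    calc _ = P.map (algebraMap 𝕎 K) * ((p : K) ^ e • Matrix.diagonal (fun l => (p : K) ^ (k l : ℤ)))
          * (Matrix.diagonal fun l => (v l : 𝕎)).map (algebraMap 𝕎 K) * Q.map (algebraMap 𝕎 K) := by
          simp only [Matrix.mul_assoc, Matrix.smul_mul, Matrix.mul_smul]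
      _ = _ := by
          rw [← h3, ← h1]
          simp only [Matrix.mul_assoc]

end Helpers3

section Helpers4

set_option linter.unusedSectionVars false

variable {p κ}

theorem Bmat_mul {m : ℕ} (hm : 0 < m) (h h' : ℤ) :
    Bmat p κ m h * Bmat p κ m h' = Bmat p κ m (h + h') := by
  have hm' : (0 : ℤ) < m := by exact_mod_cast hm
  ext r j
  rw [Matrix.mul_apply]
  have hs0 : 0 ≤ ((j : ℤ) + h') % m := Int.emod_nonneg _ hm'.ne'
  have hs1 : ((j : ℤ) + h') % m < m := Int.emod_lt_of_pos _ hm'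
  let s : Fin m := ⟨(((j : ℤ) + h') % m).toNat, by omega⟩
  have hs : ((s : ℕ) : ℤ) = ((j : ℤ) + h') % m := by
    change (((((j : ℤ) + h') % m).toNat : ℕ) : ℤ) = _
    omega
  rw [Finset.sum_eq_single s]
  · have hq : (j : ℤ) + h' = (s : ℕ) + m * (((j : ℤ) + h') / m) := by
      rw [hs]; exact (Int.emod_add_mul_ediv _ _).symm
    have e1 : ((s : ℕ) : ℤ) % m = ((j : ℤ) + h') % m := by rw [hs, Int.emod_emod_of_dvd _ dvd_rfl]
    have e2 : (j : ℤ) + (h + h') = ((s : ℕ) + h) + (((j : ℤ) + h') / m) * m := by linarith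
    simp only [Bmat, if_pos e1]
    rw [e2, Int.add_mul_emod_self_right, Int.add_mul_ediv_right _ _ hm'.ne']
    split_ifs
    · rw [zpow_add₀ pK_ne]
    · rw [zero_mul]
  · intro l _ hl
    have : ¬ ((l : ℕ) : ℤ) % m = ((j : ℤ) + h') % m := by
      intro h1
      apply hl
      have : ((l : ℕ) : ℤ) % m = l := Int.emod_eq_of_lt (by positivity) (by exact_mod_cast l.2)
      rw [this, ← hs] at h1
      exact Fin.ext (by exact_mod_cast h1)
    simp only [Bmat, if_neg this, mul_zero]
  · simp

theorem Bmat_smul {m : ℕ} (hm : 0 < m) (q : ℤ) :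
    Bmat p κ m (m * q) = Matrix.diagonal fun _ => (p : K) ^ q := by
  have hm' : (0 : ℤ) < m := by exact_mod_cast hm
  ext r j
  have hr : ((r : ℕ) : ℤ) % m = r := Int.emod_eq_of_lt (by positivity) (by exact_mod_cast r.2)
  have hj : ((j : ℕ) : ℤ) % m = j := Int.emod_eq_of_lt (by positivity) (by exact_mod_cast j.2)
  have hj2 : ((j : ℕ) : ℤ) / m = 0 := Int.ediv_eq_zero_of_lt (by positivity) (by exact_mod_cast j.2)
  rw [Bmat, Matrix.diagonal_apply, Int.add_mul_emod_self_left, hr, hj,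
    Int.add_mul_ediv_left _ _ hm'.ne', hj2, zero_add]
  congr 1
  simp [Fin.ext_iff]

theorem Bmat_pow {m : ℕ} (hm : 0 < m) (h : ℤ) (i : ℕ) :
    Bmat p κ m h ^ i = Bmat p κ m (i * h) := by
  induction i with
  | zero =>
    have := Bmat_smul (p := p) (κ := κ) hm 0
    simp at this
    simp [this]
  | succ i ih =>
    rw [pow_succ, ih, Bmat_mul hm]
    congr 1
    push_cast; ring

theorem BlockData.m_dvd {n : ℕ} (D : BlockData n) (i : Fin D.len) : D.m i ∣ n.factorial := by
  apply Nat.dvd_factorial (D.m_pos i)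
  have := Fintype.card_le_of_injective (fun a : Fin (D.m i) => D.equiv ⟨i, a⟩)
    (fun a b hab => by simpa using hab)
  simpa using this

/-- The integers `n! ν_j`. -/
def xOf {n : ℕ} (D : BlockData n) (j : Fin n) : ℤ :=
  (n.factorial / D.m (D.equiv.symm j).1 : ℕ) * D.h (D.equiv.symm j).1

theorem xOf_eq {n : ℕ} (D : BlockData n) (j : Fin n) :
    (xOf D j : ℚ) = n.factorial * nuOf D j := by
  have h0 : (D.m (D.equiv.symm j).1 : ℚ) ≠ 0 := by exact_mod_cast (D.m_pos _).ne'
  rw [xOf, nuOf]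
  rw [Int.cast_mul, Int.cast_natCast, Nat.cast_div (D.m_dvd _) h0]
  ring

theorem nuOf_antitone {n : ℕ} (D : BlockData n) : Antitone (nuOf D) := by
  intro j j' hj
  apply D.slopes_antitone
  by_contra hlt
  push Not at hlt
  have h1 := D.equiv_val (D.equiv.symm j)
  have h2 := D.equiv_val (D.equiv.symm j')
  rw [Equiv.apply_symm_apply] at h1 h2
  have h3 := (D.equiv.symm j').2.2
  have h4 : (∑ i : Fin D.len, if i < (D.equiv.symm j').1 then D.m i else 0) +
      D.m (D.equiv.symm j').1 ≤ ∑ i : Fin D.len, if i < (D.equiv.symm j).1 then D.m i else 0 := by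
    have h5 : D.m (D.equiv.symm j').1 =
        ∑ i : Fin D.len, if i = (D.equiv.symm j').1 then D.m i else 0 := by simp
    rw [h5, ← Finset.sum_add_distrib]
    refine Finset.sum_le_sum fun i _ => ?_
    rcases lt_trichotomy i (D.equiv.symm j').1 with h | h | h
    · rw [if_pos h, if_neg h.ne, if_pos (h.trans hlt), add_zero]
    · rw [if_neg h.not_lt, if_pos h, if_pos (h ▸ hlt), zero_add]
    · rw [if_neg h.not_gt, if_neg h.ne']; simp
  have : (j : ℕ) ≤ j' := hj
  omega

theorem xOf_antitone {n : ℕ} (D : BlockData n) : Antitone (xOf D) := by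
  intro j j' hj
  have h := nuOf_antitone D hj
  have : (xOf D j' : ℚ) ≤ xOf D j := by
    rw [xOf_eq, xOf_eq]
    exact mul_le_mul_of_nonneg_left h (by positivity)
  exact_mod_cast this

theorem minMatrix_fixed {n : ℕ} (σ : K ≃+* K) (D : BlockData n) :
    (minMatrix p κ D).map σ = minMatrix p κ D := by
  ext r c
  simp only [minMatrix, Matrix.map_apply, Matrix.submatrix_apply, Matrix.blockDiagonal'_apply]
  split_ifs
  · simp only [Bmat]
    split_ifs
    · exact sigma_p σ _
    · exact map_zero σ
  · exact map_zero σ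

theorem minMatrix_pow {n : ℕ} (D : BlockData n) :
    minMatrix p κ D ^ n.factorial = Matrix.diagonal fun l => (p : K) ^ xOf D l := by
  have h1 : ∀ k : ℕ, minMatrix p κ D ^ k =
      ((Matrix.blockDiagonal' fun i => Bmat p κ (D.m i) (D.h i)) ^ k).submatrix
        D.equiv.symm D.equiv.symm := by
    intro k
    induction k with
    | zero => simp
    | succ k ih =>
      rw [pow_succ, ih, pow_succ, minMatrix, Matrix.submatrix_mul_equiv]
  rw [h1, ← Matrix.blockDiagonal'_pow]
  have h2 : ((fun i => Bmat p κ (D.m i) (D.h i)) ^ n.factorial) = fun i =>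
      Matrix.diagonal fun _ : Fin (D.m i) =>
        (p : K) ^ (((n.factorial / D.m i : ℕ) : ℤ) * D.h i) := by
    ext1 i
    rw [Pi.pow_apply, Bmat_pow (D.m_pos i), ← Bmat_smul (D.m_pos i)]
    congr 1
    obtain ⟨q, hq⟩ := D.m_dvd i
    rw [hq, Nat.mul_div_cancel_left _ (D.m_pos i)]
    push_cast; ring
  rw [h2, Matrix.blockDiagonal'_diagonal, Matrix.submatrix_diagonal_equiv]
  rfl

theorem twisted_formula {n : ℕ} (σ : K ≃+* K) (D : BlockData n) {b g : Matrix (Fin n) (Fin n) K}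
    (hg : IsUnit g.det) (hb : b = g⁻¹ * minMatrix p κ D * g.map σ) (i : ℕ) :
    twistedPow p κ σ b (n.factorial * i) =
      g⁻¹ * Matrix.diagonal (fun l => (p : K) ^ (i * xOf D l)) * g.map σ^[n.factorial * i] := by
  rw [twistedPow_conj σ hg hb, twistedPow_fixed σ (minMatrix_fixed σ D), pow_mul, minMatrix_pow,
    Matrix.diagonal_pow]
  congr 3
  ext l
  rw [Pi.pow_apply, mul_comm, _root_.zpow_mul, zpow_natCast]

theorem sum_xOf {n : ℕ} {σ : K ≃+* K} (hσ : IsFrob σ) (D : BlockData n)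
    {b g : Matrix (Fin n) (Fin n) K}
    (hg : IsUnit g.det) (hb : b = g⁻¹ * minMatrix p κ D * g.map σ)
    {μ : Fin n → ℤ} (hμ : IsHodgePoint p κ b μ) :
    ∑ l, xOf D l = n.factorial * ∑ l, μ l := by
  have h1 := twistedPow_det hσ hμ.det (n.factorial * 1)
  rw [twisted_formula σ D hg hb, Matrix.det_mul, Matrix.det_mul, Matrix.det_diagonal,
    det_map_iter] at h1
  obtain ⟨a, ha⟩ := HasVal.ex hg.ne_zero
  have h2 : HasVal (g⁻¹).det (-a) := by
    rw [Matrix.det_nonsing_inv, Ring.inverse_eq_inv']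
    exact ha.inv
  have h3 : HasVal (∏ i, (p : K) ^ (((1 : ℕ) : ℤ) * xOf D i)) (∑ l, ((1 : ℕ) : ℤ) * xOf D l) :=
    HasVal.prod _ _ fun i => HasVal.p_zpow _
  have h4 := h1.unique ((h2.mul h3).mul (ha.sigma_iter hσ _))
  simp only [Nat.cast_one, one_mul, mul_one] at h4
  linarith

theorem near {n : ℕ} {σ : K ≃+* K} (hσ : IsFrob σ) (D : BlockData n)
    {b g : Matrix (Fin n) (Fin n) K}
    (hg : IsUnit g.det) (hb : b = g⁻¹ * minMatrix p κ D * g.map σ)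
    {μ₁ : Fin n → ℤ} (hμ₁ : IsHodgePoint p κ b μ₁) {c : ℤ} (hc : ∀ l, c ≤ μ₁ l) (i : ℕ)
    {μ : Fin n → ℤ} (hμ : IsHodgePoint p κ (twistedPow p κ σ b (n.factorial * i)) μ) (t : Fin n) :
    i * xOf D t - n * (n.factorial * (∑ l, μ₁ l - n * c)) ≤ μ t ∧
    μ t ≤ i * xOf D t + (n - 1) * (n * (n.factorial * (∑ l, μ₁ l - n * c))) := by
  have H := twisted_formula σ D hg hb
  have hs := sum_xOf hσ D hg hb hμ₁
  set Y : ℤ := n.factorial * (∑ l, μ₁ l - n * c) with hY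
  have hcard : ((Finset.univ.erase t).card : ℤ) = n - 1 := by
    rw [Finset.card_erase_of_mem (Finset.mem_univ t), Finset.card_univ, Fintype.card_fin]
    have := t.pos
    omega
  have hxge : ∀ t, (n.factorial : ℤ) * c ≤ xOf D t := fun t =>
    slope_ge hσ hg _ _ H hμ₁ hc t
  have hxY : ∀ t, xOf D t - n.factorial * c ≤ Y := by
    intro t
    have h1 : xOf D t - n.factorial * c ≤ ∑ l, (xOf D l - n.factorial * c) :=
      Finset.single_le_sum (f := fun l => xOf D l - n.factorial * c)
        (fun l _ => sub_nonneg.mpr (hxge l)) (Finset.mem_univ t)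
    rw [Finset.sum_sub_distrib, hs] at h1
    simp only [Finset.sum_const, Finset.card_univ, Fintype.card_fin, nsmul_eq_mul] at h1
    rw [hY]; linarith
  have hlow : ∀ t, i * xOf D t - n * Y ≤ μ t := by
    intro t
    have h1 := hodge_lower hσ hg _ _ (xOf_antitone D) H hμ₁ hc i hμ t
    have h2 : (n : ℤ) * (xOf D t - n.factorial * c) ≤ n * Y :=
      mul_le_mul_of_nonneg_left (hxY t) (by positivity)
    linarith
  refine ⟨hlow t, ?_⟩
  have hsum : ∑ l, μ l = i * ∑ l, xOf D l := by
    have h1 := hμ.det.unique (twistedPow_det hσ hμ₁.det (n.factorial * i))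
    rw [h1, hs]; push_cast; ring
  have h3 : ∑ l ∈ Finset.univ.erase t, (-(n * Y) : ℤ) ≤
      ∑ l ∈ Finset.univ.erase t, (μ l - i * xOf D l) :=
    Finset.sum_le_sum fun l _ => by linarith [hlow l]
  have h4 : ∑ l, (μ l - i * xOf D l) = 0 := by
    rw [Finset.sum_sub_distrib, hsum, Finset.mul_sum, sub_self]
  rw [← Finset.add_sum_erase _ _ (Finset.mem_univ t)] at h4
  rw [Finset.sum_const, nsmul_eq_mul, hcard] at h3
  linarith

end Helpers4

theorem statement_11 (n : ℕ) (hn : 1 ≤ n)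
    (σ : K ≃+* K)
    (hσ : ∀ x : 𝕎, σ (algebraMap 𝕎 K x) = algebraMap 𝕎 K (WittVector.frobenius x))
    (μ₁ : Fin n → ℤ) (hμ₁ : Antitone μ₁) :
    ∃ C' : ℕ, ∀ N : ℕ, C' < N →
      ∀ D D' : BlockData n,
      ∀ b b' : Matrix (Fin n) (Fin n) K, IsUnit b.det → IsUnit b'.det →
        (∃ g : Matrix (Fin n) (Fin n) K, IsUnit g.det ∧
          b = g⁻¹ * minMatrix p κ D * g.map ⇑σ) →
        (∃ g : Matrix (Fin n) (Fin n) K, IsUnit g.det ∧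
          b' = g⁻¹ * minMatrix p κ D' * g.map ⇑σ) →
        IsHodgePoint p κ b μ₁ → IsHodgePoint p κ b' μ₁ →
        (∀ i, 1 ≤ i → i ≤ N → ∀ μ : Fin n → ℤ,
          IsHodgePoint p κ (twistedPow p κ σ b i) μ ↔
            IsHodgePoint p κ (twistedPow p κ σ b' i) μ) →
        nuOf D = nuOf D' := by
  have hσ' : IsFrob σ := hσ
  obtain ⟨c, hc⟩ := (Set.finite_range μ₁).bddBelow
  have hc' : ∀ l, c ≤ μ₁ l := fun l => hc ⟨l, rfl⟩
  set Z : ℤ := n * (n * (n.factorial * (∑ l, μ₁ l - n * c))) with hZ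
  set i : ℕ := Z.toNat + 1 with hi
  refine ⟨n.factorial * i, ?_⟩
  rintro N hN D D' b b' hbdet hbdet' ⟨g, hg, hb⟩ ⟨g', hg', hb'⟩ hμ hμ' heq
  have hdet : (twistedPow p κ σ b (n.factorial * i)).det ≠ 0 := by
    obtain ⟨u, hu, h⟩ := twistedPow_det hσ' hμ.det (n.factorial * i)
    rw [h]
    refine mul_ne_zero (zpow_ne_zero _ pK_ne) ?_
    rw [Ne, FaithfulSMul.algebraMap_eq_zero_iff]
    exact hu.ne_zero
  obtain ⟨μ, hm⟩ := hodge_exists _ hdet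
  have hm' := (heq (n.factorial * i)
    (Nat.mul_pos (Nat.factorial_pos n) (Nat.succ_pos _)) hN.le μ).mp hm
  funext t
  obtain ⟨l1, l2⟩ := near hσ' D hg hb hμ hc' i hm t
  obtain ⟨l3, l4⟩ := near hσ' D' hg' hb' hμ' hc' i hm' t
  have hiZ : Z < i := by
    rw [hi]; push_cast
    have := Int.self_le_toNat Z
    omega
  have k1 : (i : ℤ) * (xOf D t - xOf D' t) ≤ Z := by rw [hZ]; linarith
  have k2 : (i : ℤ) * (xOf D' t - xOf D t) ≤ Z := by rw [hZ]; linarith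
  have hipos : (0 : ℤ) < i := by rw [hi]; positivity
  have hx : xOf D t = xOf D' t := by
    rcases lt_trichotomy (xOf D t) (xOf D' t) with h | h | h
    · nlinarith
    · exact h
    · nlinarith
  have hq : (n.factorial : ℚ) * nuOf D t = n.factorial * nuOf D' t := by
    rw [← xOf_eq, ← xOf_eq, hx]
  exact mul_left_cancel₀ (by exact_mod_cast (Nat.factorial_pos n).ne') hq

end
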